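/- Let n ≥ 1, −n < a < +∞, 1 ≤ p < +∞ and C_n > 0. Suppose u ∈ C(cl(ℝⁿ₊)) is a nonnegative solution of u(x) = ∫_{ℝⁿ₊} G⁺(x,y) |y|^a u(y)^p dy on ℝⁿ₊ which is not identically zero (equivalently, u is positive on ℝⁿ₊). Then u satisfies the following lower bound estimates in the cone: for every κ < +∞ there exists a constant C_κ > 0 such that u(x) ≥ C_κ |x|^κ for all x ∈ ℝⁿ₊ with |x| ≥ 1 and xₙ ≥ |x|/√n. -/

import Mathlib

open MeasureTheory Real Set Metric

noncomputable section

abbrev E (n : ℕ) := EuclideanSpace ℝ (Fin n)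

/-- The last coordinate `xₙ` of a point `x ∈ ℝⁿ` (junk value `0` when `n = 0`). -/
def lastCoord (n : ℕ) (x : E n) : ℝ :=
  if h : 0 < n then x ⟨n - 1, Nat.sub_lt h Nat.one_pos⟩ else 0

/-- The upper half space `ℝⁿ₊ = {x : xₙ > 0}`. -/
def halfSpace (n : ℕ) : Set (E n) := {x | 0 < lastCoord n x}

/-- The last standard basis vector `eₙ`. -/
def lastBasis (n : ℕ) : E n :=
  if h : 0 < n then EuclideanSpace.single ⟨n - 1, Nat.sub_lt h Nat.one_pos⟩ (1 : ℝ) else 0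

/-- The reflection `x̄ = (x₁, …, x_{n−1}, −xₙ)` of `x` across `∂ℝⁿ₊`. -/
def reflect (n : ℕ) (x : E n) : E n := x - (2 * lastCoord n x) • lastBasis n

/-- The kernel `G⁺(x,y) = C_n (ln(1/|x−y|) − ln(1/|x̄−y|))`, the Green function of
`(−Δ)^{n/2}` on the half space with Navier boundary conditions. -/
def Gplus (n : ℕ) (Cn : ℝ) (x y : E n) : ℝ :=
  Cn * (Real.log (1 / ‖x - y‖) - Real.log (1 / ‖reflect n x - y‖))

/-- The Laplacian `Δu = ∑ᵢ ∂²u/∂xᵢ²`. -/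
def lap (n : ℕ) (u : E n → ℝ) (x : E n) : ℝ :=
  ∑ i, fderiv ℝ (fun y => fderiv ℝ u y (EuclideanSpace.single i 1)) x
    (EuclideanSpace.single i 1)

/-- The iterate `(−Δ)^k u` of the negative Laplacian. -/
def negLapIter (n k : ℕ) (u : E n → ℝ) : E n → ℝ :=
  (fun v x => - lap n v x)^[k] u

open EuclideanGeometry Filter Topology

theorem lastCoord_smul (n : ℕ) (c : ℝ) (x : E n) :
    lastCoord n (c • x) = c * lastCoord n x := by
  unfold lastCoord; split_ifs <;> simp

theorem continuous_lastCoord (n : ℕ) : Continuous (lastCoord n) := by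
  unfold lastCoord; split_ifs <;> fun_prop

theorem lastCoord_sub (n : ℕ) (x y : E n) :
    lastCoord n (x - y) = lastCoord n x - lastCoord n y := by
  unfold lastCoord; split_ifs <;> simp

theorem abs_lastCoord_le (n : ℕ) (x : E n) : |lastCoord n x| ≤ ‖x‖ := by
  unfold lastCoord; split_ifs
  · exact PiLp.norm_apply_le x _
  · simp

theorem lastCoord_le (n : ℕ) (x : E n) : lastCoord n x ≤ ‖x‖ :=
  (le_abs_self _).trans (abs_lastCoord_le n x)

theorem isOpen_halfSpace (n : ℕ) : IsOpen (halfSpace n) :=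
  isOpen_lt continuous_const (continuous_lastCoord n)

theorem norm_pos_of_mem_halfSpace {n : ℕ} {x : E n} (hx : x ∈ halfSpace n) : 0 < ‖x‖ :=
  lt_of_lt_of_le hx (lastCoord_le n x)

theorem ne_zero_of_mem_halfSpace {n : ℕ} {x : E n} (hx : x ∈ halfSpace n) : x ≠ 0 :=
  norm_pos_iff.1 (norm_pos_of_mem_halfSpace hx)

theorem smul_mem_halfSpace {n : ℕ} {x : E n} (hx : x ∈ halfSpace n) {c : ℝ} (hc : 0 < c) :
    c • x ∈ halfSpace n := by
  change 0 < lastCoord n (c • x)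
  rw [lastCoord_smul]; exact mul_pos hc hx

theorem norm_lastBasis {n : ℕ} (hn : 0 < n) : ‖lastBasis n‖ = 1 := by
  simp [lastBasis, hn]

theorem lastCoord_lastBasis {n : ℕ} (hn : 0 < n) : lastCoord n (lastBasis n) = 1 := by
  simp [lastBasis, lastCoord, hn]

theorem inner_lastBasis {n : ℕ} (hn : 0 < n) (x : E n) :
    inner ℝ x (lastBasis n) = lastCoord n x := by
  simp [lastBasis, lastCoord, hn, EuclideanSpace.inner_single_right]

theorem norm_reflect_sub_sq {n : ℕ} (hn : 0 < n) (x y : E n) :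
    ‖reflect n x - y‖ ^ 2 = ‖x - y‖ ^ 2 + 4 * lastCoord n x * lastCoord n y := by
  have h : reflect n x - y = (x - y) - (2 * lastCoord n x) • lastBasis n := by
    unfold reflect; abel
  rw [h, norm_sub_sq_real, inner_smul_right, inner_lastBasis hn, lastCoord_sub, norm_smul,
    norm_lastBasis hn, Real.norm_eq_abs, mul_one, sq_abs]
  ring

/-- The logarithmic Green kernel, normalised so that `G⁺ = (C_n / 2) * logKernel` off the
diagonal. -/
def logKernel (n : ℕ) (x y : E n) : ℝ :=
  Real.log (1 + 4 * lastCoord n x * lastCoord n y / ‖x - y‖ ^ 2)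

theorem logKernel_nonneg {n : ℕ} {x y : E n} (hx : x ∈ halfSpace n) (hy : y ∈ halfSpace n) :
    0 ≤ logKernel n x y := by
  apply Real.log_nonneg
  have h1 : 0 < lastCoord n x := hx
  have h2 : 0 < lastCoord n y := hy
  have : 0 ≤ 4 * lastCoord n x * lastCoord n y / ‖x - y‖ ^ 2 := by positivity
  linarith

theorem measurable_logKernel (n : ℕ) (x : E n) : Measurable (logKernel n x) := by
  unfold logKernel
  have := (continuous_lastCoord n).measurable
  fun_prop

theorem Gplus_eq_logKernel {n : ℕ} (hn : 0 < n) (Cn : ℝ) {x y : E n} (hx : x ∈ halfSpace n)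
    (hy : y ∈ halfSpace n) (hxy : y ≠ x) :
    Gplus n Cn x y = Cn / 2 * logKernel n x y := by
  have h1 : 0 < lastCoord n x := hx
  have h2 : 0 < lastCoord n y := hy
  have h0 : 0 < ‖x - y‖ := norm_pos_iff.2 (sub_ne_zero.2 hxy.symm)
  have h3 : 0 < ‖reflect n x - y‖ := by
    have := norm_reflect_sub_sq hn x y
    have h4 : 0 < ‖reflect n x - y‖ ^ 2 := by rw [this]; positivity
    exact lt_of_le_of_ne (norm_nonneg _) fun h => by simp [← h] at h4
  have h5 : 1 + 4 * lastCoord n x * lastCoord n y / ‖x - y‖ ^ 2 =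
      (‖reflect n x - y‖ / ‖x - y‖) ^ 2 := by
    rw [div_pow, norm_reflect_sub_sq hn, eq_div_iff (by positivity)]
    field_simp
  unfold Gplus logKernel
  rw [h5, Real.log_pow, Real.log_div h3.ne' h0.ne', one_div, one_div, Real.log_inv, Real.log_inv]
  push_cast
  ring

theorem inversion_zero_eq {n : ℕ} (l : ℝ) (x : E n) :
    inversion (0 : E n) l x = (l / ‖x‖) ^ 2 • x := by
  simp [inversion]

theorem norm_inversion_zero {n : ℕ} (l : ℝ) (x : E n) :
    ‖inversion (0 : E n) l x‖ = l ^ 2 / ‖x‖ := by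
  simpa using dist_inversion_center (0 : E n) x l

theorem inversion_mem_halfSpace {n : ℕ} {l : ℝ} (hl : 0 < l) {x : E n} (hx : x ∈ halfSpace n) :
    inversion (0 : E n) l x ∈ halfSpace n := by
  rw [inversion_zero_eq]
  have := norm_pos_of_mem_halfSpace hx
  exact smul_mem_halfSpace hx (by positivity)

theorem logKernel_inversion_inversion {n : ℕ} {l : ℝ} (hl : 0 < l) {x y : E n}
    (hx : x ∈ halfSpace n) (hy : y ∈ halfSpace n) :
    logKernel n (inversion 0 l x) (inversion 0 l y) = logKernel n x y := by
  have hx0 := norm_pos_of_mem_halfSpace hx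
  have hy0 := norm_pos_of_mem_halfSpace hy
  have h := dist_inversion_inversion (c := (0 : E n)) (ne_zero_of_mem_halfSpace hx)
    (ne_zero_of_mem_halfSpace hy) l
  rw [dist_eq_norm, dist_zero_right, dist_zero_right, dist_eq_norm] at h
  unfold logKernel
  rw [h, inversion_zero_eq, inversion_zero_eq, lastCoord_smul, lastCoord_smul]
  congr 2
  rcases eq_or_ne x y with rfl | hxy
  · simp
  have h0 : 0 < ‖x - y‖ := norm_pos_iff.2 (sub_ne_zero.2 hxy)
  field_simp

theorem logKernel_inversion_left {n : ℕ} {l : ℝ} (hl : 0 < l) {x y : E n}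
    (hx : x ∈ halfSpace n) (hy : y ∈ halfSpace n) :
    logKernel n (inversion 0 l x) y = logKernel n x (inversion 0 l y) := by
  rw [← logKernel_inversion_inversion hl hx (inversion_mem_halfSpace hl hy),
    inversion_inversion _ hl.ne']

theorem norm_inversion_sub_sq {n : ℕ} (l : ℝ) {x : E n} (hx : x ≠ 0) (y : E n) :
    ‖inversion 0 l x - y‖ ^ 2 * ‖x‖ ^ 2 =
      l ^ 2 * ‖x - y‖ ^ 2 + (l ^ 2 - ‖x‖ ^ 2) * (l ^ 2 - ‖y‖ ^ 2) := by
  have h0 : 0 < ‖x‖ := norm_pos_iff.2 hx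
  rw [inversion_zero_eq, norm_sub_sq_real, norm_sub_sq_real, inner_smul_left, norm_smul,
    Real.norm_eq_abs, mul_pow, sq_abs]
  simp only [conj_trivial]
  field_simp
  ring

theorem logKernel_inversion_lt {n : ℕ} {l : ℝ} {x y : E n}
    (hx : x ∈ halfSpace n) (hy : y ∈ halfSpace n) (hxl : ‖x‖ < l) (hyl : ‖y‖ < l)
    (hxy : y ≠ x) :
    logKernel n (inversion 0 l x) y < logKernel n x y := by
  have hx0 := norm_pos_of_mem_halfSpace hx
  have hy0 := norm_pos_of_mem_halfSpace hy
  have hl : 0 < l := hx0.trans hxl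
  have h1 : 0 < lastCoord n x := hx
  have h2 : 0 < lastCoord n y := hy
  have h0 : 0 < ‖x - y‖ := norm_pos_iff.2 (sub_ne_zero.2 hxy.symm)
  have key := norm_inversion_sub_sq l (ne_zero_of_mem_halfSpace hx) y
  have h3 : 0 < (l ^ 2 - ‖x‖ ^ 2) * (l ^ 2 - ‖y‖ ^ 2) := by
    apply mul_pos <;> nlinarith
  unfold logKernel
  rw [inversion_zero_eq, lastCoord_smul, ← inversion_zero_eq]
  have h4 : 4 * ((l / ‖x‖) ^ 2 * lastCoord n x) * lastCoord n y / ‖inversion 0 l x - y‖ ^ 2 =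
      4 * lastCoord n x * lastCoord n y * l ^ 2 /
        (‖inversion 0 l x - y‖ ^ 2 * ‖x‖ ^ 2) := by
    rw [div_pow, mul_comm (‖inversion 0 l x - y‖ ^ 2), ← div_div]
    congr 1
    ring
  rw [h4, key]
  apply Real.log_lt_log (by positivity)
  gcongr 1 + ?_
  rw [div_lt_div_iff₀ (by positivity) (by positivity)]
  have h5 : 0 < 4 * lastCoord n x * lastCoord n y := by positivity
  nlinarith [mul_pos h5 h3]

theorem integrableOn_norm_rpow_ball {n : ℕ} (hn : 0 < n) {b : ℝ} (hb : -(n : ℝ) < b) (r : ℝ) :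
    IntegrableOn (fun x : E n => ‖x‖ ^ b) (ball 0 r) := by
  have : Nonempty (Fin n) := ⟨⟨0, hn⟩⟩
  rcases le_or_gt r 0 with hr | hr
  · simp [ball_eq_empty.2 hr]
  rw [integrableOn_fun_norm_addHaar volume (f := fun t => t ^ b), finrank_euclideanSpace_fin]
  have h := (intervalIntegral.integrableOn_Ioo_rpow_iff (s := (n - 1 : ℕ) + b) hr).2 (by
    rw [Nat.cast_sub hn]; push_cast; linarith)
  refine h.congr_fun (fun t ht => ?_) measurableSet_Ioo
  simp only [smul_eq_mul]
  rw [Real.rpow_add ht.1, Real.rpow_natCast]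

theorem logKernel_mul_rpow_le {n : ℕ} {a R : ℝ} (ha : -(n : ℝ) < a) (hn : 0 < n)
    (hR : 0 < R) :
    ∃ b : ℝ, -(n : ℝ) < b ∧ ∃ C : ℝ, 0 ≤ C ∧ ∀ x ∈ halfSpace n, ∀ y ∈ halfSpace n,
      ‖x‖ < R → ‖y‖ < R →
        logKernel n x y * ‖y‖ ^ a ≤ C * (‖x - y‖ ^ b + ‖y‖ ^ b) := by
  have hn' : (0 : ℝ) < n := Nat.cast_pos.2 hn
  obtain ⟨m, hm⟩ : ∃ m, m = min a 0 := ⟨_, rfl⟩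
  have hma : m ≤ a := hm ▸ min_le_left _ _
  have hm0 : m ≤ 0 := hm ▸ min_le_right _ _
  have hmn : -(n : ℝ) < m := hm ▸ lt_min ha (by linarith)
  obtain ⟨e, he⟩ : ∃ e, e = (n + m) / 2 := ⟨_, rfl⟩
  have he0 : 0 < e := by rw [he]; linarith
  refine ⟨m - e, by rw [he]; linarith, 2 * (3 * R) ^ e / e * R ^ (a - m), by positivity, ?_⟩
  intro x hx y hy hxR hyR
  have hx0 : 0 < lastCoord n x := hx
  have hy0 : 0 < lastCoord n y := hy
  have hyn := norm_pos_of_mem_halfSpace hy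
  rcases eq_or_ne x y with rfl | hxy
  · simp [logKernel]; positivity
  have hd : 0 < ‖x - y‖ := norm_pos_iff.2 (sub_ne_zero.2 hxy)
  have hdR : ‖x - y‖ ≤ 2 * R := (norm_sub_le x y).trans (by linarith)
  have h1 : logKernel n x y ≤ 2 * (3 * R) ^ e / e * ‖x - y‖ ^ (-e) := by
    have hle : 1 + 4 * lastCoord n x * lastCoord n y / ‖x - y‖ ^ 2 ≤ (3 * R / ‖x - y‖) ^ 2 := by
      rw [div_pow, le_div_iff₀ (by positivity), add_mul, div_mul_cancel₀ _ (by positivity)]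
      have h2 : lastCoord n x * lastCoord n y ≤ R * R := by
        have := lastCoord_le n x
        have := lastCoord_le n y
        gcongr <;> linarith
      nlinarith
    calc logKernel n x y ≤ Real.log ((3 * R / ‖x - y‖) ^ 2) :=
          Real.log_le_log (by positivity) hle
      _ = 2 * Real.log (3 * R / ‖x - y‖) := by rw [Real.log_pow]; norm_num
      _ ≤ 2 * ((3 * R / ‖x - y‖) ^ e / e) := by
          gcongr; exact Real.log_le_rpow_div (by positivity) he0
      _ = _ := by
          rw [Real.div_rpow (by positivity) hd.le, Real.rpow_neg hd.le]
          field_simp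
  have h2 : ‖y‖ ^ a ≤ R ^ (a - m) * ‖y‖ ^ m := by
    have : ‖y‖ ^ a = ‖y‖ ^ (a - m) * ‖y‖ ^ m := by
      rw [← Real.rpow_add hyn]; ring_nf
    rw [this]
    gcongr
  have h3 : ‖x - y‖ ^ (-e) * ‖y‖ ^ m ≤ ‖x - y‖ ^ (m - e) + ‖y‖ ^ (m - e) := by
    have hs (t : ℝ) (ht : 0 < t) : t ^ (m - e) = t ^ (-e) * t ^ m := by
      rw [← Real.rpow_add ht]; ring_nf
    rcases le_total ‖x - y‖ ‖y‖ with h | h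
    · have : ‖x - y‖ ^ (-e) * ‖y‖ ^ m ≤ ‖x - y‖ ^ (m - e) := by
        rw [hs _ hd]
        gcongr _ * ?_
        exact Real.rpow_le_rpow_of_nonpos hd h hm0
      linarith [Real.rpow_nonneg hyn.le (m - e)]
    · have : ‖x - y‖ ^ (-e) * ‖y‖ ^ m ≤ ‖y‖ ^ (m - e) := by
        rw [hs _ hyn]
        gcongr ?_ * _
        exact Real.rpow_le_rpow_of_nonpos hyn h (by linarith)
      linarith [Real.rpow_nonneg hd.le (m - e)]
  calc logKernel n x y * ‖y‖ ^ a
      ≤ (2 * (3 * R) ^ e / e * ‖x - y‖ ^ (-e)) * (R ^ (a - m) * ‖y‖ ^ m) := by gcongr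
    _ = 2 * (3 * R) ^ e / e * R ^ (a - m) * (‖x - y‖ ^ (-e) * ‖y‖ ^ m) := by ring
    _ ≤ _ := by gcongr

theorem exists_logKernel_majorant {n : ℕ} (hn : 0 < n) {a R : ℝ} (ha : -(n : ℝ) < a)
    (hR : 0 < R) :
    ∃ C : ENNReal, C ≠ ⊤ ∧ ∃ g : E n → ENNReal, Measurable g ∧ ∫⁻ z, g z ≠ ⊤ ∧
      ∀ x ∈ halfSpace n, ∀ y ∈ halfSpace n, ‖x‖ < R → ‖y‖ < R →
        ENNReal.ofReal (logKernel n x y * ‖y‖ ^ a) ≤ C * (g (x - y) + g y) := by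
  obtain ⟨b, hb, C, hC, h⟩ := logKernel_mul_rpow_le ha hn hR
  have hmeas : Measurable fun z : E n => ENNReal.ofReal (‖z‖ ^ b) := by fun_prop
  refine ⟨ENNReal.ofReal C, ENNReal.ofReal_ne_top,
    (ball 0 (2 * R)).indicator fun z => ENNReal.ofReal (‖z‖ ^ b),
    hmeas.indicator measurableSet_ball, ?_, ?_⟩
  · rw [lintegral_indicator measurableSet_ball]
    exact (integrableOn_norm_rpow_ball hn hb (2 * R)).lintegral_lt_top.ne
  · intro x hx y hy hxR hyR
    have h1 : x - y ∈ ball (0 : E n) (2 * R) := by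
      rw [mem_ball_zero_iff]; linarith [norm_sub_le x y]
    have h2 : y ∈ ball (0 : E n) (2 * R) := by rw [mem_ball_zero_iff]; linarith
    rw [indicator_of_mem h1, indicator_of_mem h2, ← ENNReal.ofReal_add (by positivity)
      (by positivity), ← ENNReal.ofReal_mul hC]
    exact ENNReal.ofReal_le_ofReal (h x hx y hy hxR hyR)

theorem setLIntegral_sub_left {n : ℕ} {g : E n → ENNReal} (hg : Measurable g) {A : Set (E n)}
    (hA : MeasurableSet A) (x : E n) :
    ∫⁻ y in A, g (x - y) = ∫⁻ z in (fun t => x - t) ⁻¹' A, g z := by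
  have := (Measure.measurePreserving_sub_left (volume : Measure (E n)) x).setLIntegral_comp_preimage
    hA (f := fun y => g (x - y)) (by fun_prop)
  rw [← this]
  simp

theorem setLIntegral_logKernel_lt_top {n : ℕ} (hn : 0 < n) {a R : ℝ} (ha : -(n : ℝ) < a)
    (hR : 0 < R) {x : E n} (hx : x ∈ halfSpace n) (hxR : ‖x‖ < R) :
    ∫⁻ y in halfSpace n ∩ ball 0 R, ENNReal.ofReal (logKernel n x y * ‖y‖ ^ a) < ⊤ := by
  obtain ⟨C, hC, g, hg, hgi, h⟩ := exists_logKernel_majorant hn ha hR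
  have hA : MeasurableSet (halfSpace n ∩ ball 0 R) :=
    (isOpen_halfSpace n).measurableSet.inter measurableSet_ball
  calc ∫⁻ y in halfSpace n ∩ ball 0 R, ENNReal.ofReal (logKernel n x y * ‖y‖ ^ a)
      ≤ ∫⁻ y in halfSpace n ∩ ball 0 R, C * (g (x - y) + g y) :=
        setLIntegral_mono (by fun_prop) fun y hy =>
          h x hx y hy.1 hxR (mem_ball_zero_iff.1 hy.2)
    _ = C * ((∫⁻ y in halfSpace n ∩ ball 0 R, g (x - y)) +
          ∫⁻ y in halfSpace n ∩ ball 0 R, g y) := by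
        rw [lintegral_const_mul _ (by fun_prop), lintegral_add_left (by fun_prop)]
    _ ≤ C * ((∫⁻ y, g y) + ∫⁻ y, g y) := by
        rw [setLIntegral_sub_left hg hA]
        gcongr <;> exact Measure.restrict_le_self
    _ < ⊤ := ENNReal.mul_lt_top hC.lt_top (ENNReal.add_lt_top.2 ⟨hgi.lt_top, hgi.lt_top⟩)

theorem exists_setLIntegral_logKernel_le {n : ℕ} (hn : 0 < n) {a R : ℝ} (ha : -(n : ℝ) < a)
    (hR : 0 < R) {e : ENNReal} (he : e ≠ 0) :
    ∃ d : ENNReal, 0 < d ∧ ∀ A : Set (E n), MeasurableSet A → A ⊆ halfSpace n ∩ ball 0 R →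
      volume A < d → ∀ x ∈ halfSpace n, ‖x‖ < R →
        ∫⁻ y in A, ENNReal.ofReal (logKernel n x y * ‖y‖ ^ a) ≤ e := by
  obtain ⟨C, hC, g, hg, hgi, h⟩ := exists_logKernel_majorant hn ha hR
  have he' : e / (C + 1) / 2 ≠ 0 :=
    ENNReal.div_ne_zero.2 ⟨ENNReal.div_ne_zero.2 ⟨he, by finiteness⟩, by finiteness⟩
  obtain ⟨d, hd, hsmall⟩ := exists_pos_setLIntegral_lt_of_measure_lt hgi he'
  refine ⟨d, hd, fun A hA hAR hAd x hx hxR => ?_⟩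
  have hpre : volume ((fun t => x - t) ⁻¹' A) = volume A :=
    (Measure.measurePreserving_sub_left (volume : Measure (E n)) x).measure_preimage
      hA.nullMeasurableSet
  calc ∫⁻ y in A, ENNReal.ofReal (logKernel n x y * ‖y‖ ^ a)
      ≤ ∫⁻ y in A, C * (g (x - y) + g y) :=
        setLIntegral_mono (by fun_prop) fun y hy =>
          h x hx y (hAR hy).1 hxR (mem_ball_zero_iff.1 (hAR hy).2)
    _ = C * ((∫⁻ y in A, g (x - y)) + ∫⁻ y in A, g y) := by
        rw [lintegral_const_mul _ (by fun_prop), lintegral_add_left (by fun_prop)]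
    _ ≤ (C + 1) * (e / (C + 1) / 2 + e / (C + 1) / 2) := by
        rw [setLIntegral_sub_left hg hA]
        gcongr
        · exact le_self_add
        · exact (hsmall _ (hpre.trans_lt hAd)).le
        · exact (hsmall _ hAd).le
    _ = e := by
        rw [ENNReal.add_halves]
        exact ENNReal.mul_div_cancel (by simp) (by finiteness)

theorem integrableOn_logKernel {n : ℕ} (hn : 0 < n) {a R : ℝ} (ha : -(n : ℝ) < a)
    (hR : 0 < R) {x : E n} (hx : x ∈ halfSpace n) (hxR : ‖x‖ < R) :
    IntegrableOn (fun y => logKernel n x y * ‖y‖ ^ a) (halfSpace n ∩ ball 0 R) := by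
  have hA : MeasurableSet (halfSpace n ∩ ball 0 R) :=
    (isOpen_halfSpace n).measurableSet.inter measurableSet_ball
  have hm := measurable_logKernel n x
  refine (lintegral_ofReal_ne_top_iff_integrable ?_ ?_).1
    (setLIntegral_logKernel_lt_top hn ha hR hx hxR).ne
  · exact (by fun_prop : Measurable fun y => logKernel n x y * ‖y‖ ^ a).aestronglyMeasurable
  · filter_upwards [ae_restrict_mem hA] with y hy
    exact mul_nonneg (logKernel_nonneg hx hy.1) (by positivity)

theorem exists_setIntegral_logKernel_le {n : ℕ} (hn : 0 < n) {a R : ℝ} (ha : -(n : ℝ) < a)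
    (hR : 0 < R) {e : ℝ} (he : 0 < e) :
    ∃ d : ENNReal, 0 < d ∧ ∀ A : Set (E n), MeasurableSet A → A ⊆ halfSpace n ∩ ball 0 R →
      volume A < d → ∀ x ∈ halfSpace n, ‖x‖ < R →
        ∫ y in A, logKernel n x y * ‖y‖ ^ a ≤ e := by
  obtain ⟨d, hd, h⟩ := exists_setLIntegral_logKernel_le hn ha hR
    (e := ENNReal.ofReal e) (by simpa using he)
  refine ⟨d, hd, fun A hA hAR hAd x hx hxR => ?_⟩
  rw [integral_eq_lintegral_of_nonneg_ae]
  · exact ENNReal.toReal_le_of_le_ofReal he.le (h A hA hAR hAd x hx hxR)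
  · filter_upwards [ae_restrict_mem hA] with y hy
    exact mul_nonneg (logKernel_nonneg hx (hAR hy).1) (by positivity)
  · exact ((integrableOn_logKernel hn ha hR hx hxR).mono_set hAR).aestronglyMeasurable

theorem ae_ne_of_pos {n : ℕ} (hn : 0 < n) (x : E n) : ∀ᵐ y : E n, y ≠ x := by
  have : Nonempty (Fin n) := ⟨⟨0, hn⟩⟩
  exact Measure.ae_ne volume x

theorem exists_logKernel_le_mul {n : ℕ} {x z : E n} (hx : x ∈ halfSpace n)
    (hz : z ∈ halfSpace n) :
    ∃ K : ℝ, 0 ≤ K ∧ ∀ y ∈ halfSpace n, y ≠ z → 1 ≤ ‖x - y‖ →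
      logKernel n x y ≤ K * logKernel n z y := by
  have hx0 : 0 < lastCoord n x := hx
  have hz0 : 0 < lastCoord n z := hz
  refine ⟨lastCoord n x * ((‖z - x‖ + 1) ^ 2 + 4 * lastCoord n z * (‖x‖ + 1)) / lastCoord n z,
    by positivity, fun y hy hyz hxy => ?_⟩
  have hy0 : 0 < lastCoord n y := hy
  have hzy : 0 < ‖z - y‖ := norm_pos_iff.2 (sub_ne_zero.2 hyz.symm)
  have hd : 0 < ‖x - y‖ := by linarith
  have hupper : logKernel n x y ≤ 4 * lastCoord n x * lastCoord n y / ‖x - y‖ ^ 2 := by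
    refine (Real.log_le_sub_one_of_pos (by positivity)).trans ?_
    linarith
  have hlower : 4 * lastCoord n z * lastCoord n y /
      (‖z - y‖ ^ 2 + 4 * lastCoord n z * lastCoord n y) ≤ logKernel n z y := by
    refine le_trans (le_of_eq ?_) (Real.one_sub_inv_le_log_of_pos (by positivity))
    field_simp
    ring
  have h1 : ‖z - y‖ ≤ (‖z - x‖ + 1) * ‖x - y‖ := by
    have := norm_sub_le_norm_sub_add_norm_sub z x y
    nlinarith [norm_nonneg (z - x)]
  have h2 : lastCoord n y ≤ (‖x‖ + 1) * ‖x - y‖ ^ 2 := by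
    have h3 := lastCoord_le n y
    have h4 : ‖y‖ ≤ ‖x‖ + ‖x - y‖ := by
      have := norm_sub_le x (x - y); simpa using this
    nlinarith [mul_nonneg (norm_nonneg x) (by nlinarith : 0 ≤ ‖x - y‖ ^ 2 - 1)]
  have h5 : ‖z - y‖ ^ 2 + 4 * lastCoord n z * lastCoord n y ≤
      ((‖z - x‖ + 1) ^ 2 + 4 * lastCoord n z * (‖x‖ + 1)) * ‖x - y‖ ^ 2 := by
    have h6 : ‖z - y‖ ^ 2 ≤ ((‖z - x‖ + 1) * ‖x - y‖) ^ 2 := by gcongr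
    have h7 : 4 * lastCoord n z * lastCoord n y ≤
        4 * lastCoord n z * ((‖x‖ + 1) * ‖x - y‖ ^ 2) := by gcongr
    nlinarith
  refine hupper.trans (le_trans ?_ (mul_le_mul_of_nonneg_left hlower (by positivity)))
  rw [div_mul_div_comm, div_le_div_iff₀ (by positivity) (by positivity)]
  have h8 : 0 ≤ 4 * lastCoord n x * lastCoord n y * lastCoord n z := by positivity
  nlinarith [mul_le_mul_of_nonneg_left h5 h8]

theorem exists_bound_of_continuousOn {n : ℕ} {u : E n → ℝ}
    (hu : ContinuousOn u (closure (halfSpace n))) (R : ℝ) :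
    ∃ M : ℝ, 0 < M ∧ ∀ x ∈ halfSpace n, ‖x‖ ≤ R → u x ≤ M := by
  have hK : IsCompact (closure (halfSpace n) ∩ closedBall 0 R) :=
    (isCompact_closedBall 0 R).inter_left isClosed_closure
  obtain ⟨M, hM⟩ := hK.bddAbove_image (hu.mono inter_subset_left)
  refine ⟨max M 1, by positivity, fun x hx hxR => le_max_of_le_left (hM ⟨x, ⟨?_, ?_⟩, rfl⟩)⟩
  · exact subset_closure hx
  · simpa using hxR

theorem continuousOn_rpow_halfSpace {n : ℕ} {u : E n → ℝ} {p : ℝ} (hp : 1 ≤ p)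
    (hu : ContinuousOn u (closure (halfSpace n))) :
    ContinuousOn (fun y => u y ^ p) (halfSpace n) :=
  (hu.mono subset_closure).rpow_const fun _ _ => Or.inr (by linarith)

/-- Integrability of the right-hand side at one point propagates to the whole half space. -/
theorem integrableOn_logKernel_mul_of_integrableOn {n : ℕ} (hn : 0 < n) {a p : ℝ}
    (ha : -(n : ℝ) < a) (hp : 1 ≤ p) {u : E n → ℝ}
    (hu : ContinuousOn u (closure (halfSpace n)))
    (hnonneg : ∀ x ∈ closure (halfSpace n), 0 ≤ u x) {x z : E n} (hx : x ∈ halfSpace n)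
    (hz : z ∈ halfSpace n)
    (h : IntegrableOn (fun y => logKernel n z y * ‖y‖ ^ a * u y ^ p) (halfSpace n)) :
    IntegrableOn (fun y => logKernel n x y * ‖y‖ ^ a * u y ^ p) (halfSpace n) := by
  have hH := (isOpen_halfSpace n).measurableSet
  have hup : AEStronglyMeasurable (fun y => u y ^ p) (volume.restrict (halfSpace n)) :=
    (continuousOn_rpow_halfSpace hp hu).aestronglyMeasurable hH
  have hun (y) (hy : y ∈ halfSpace n) : 0 ≤ u y := hnonneg y (subset_closure hy)
  rw [← inter_union_sdiff (halfSpace n) (ball 0 (‖x‖ + 1))]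
  refine IntegrableOn.union ?_ ?_
  · obtain ⟨M, hM0, hM⟩ := exists_bound_of_continuousOn hu (‖x‖ + 1)
    refine (integrableOn_logKernel hn ha (by positivity) hx (by linarith)).mul_bdd
      (c := M ^ p) (hup.mono_measure (Measure.restrict_mono_set _ inter_subset_left)) ?_
    filter_upwards [ae_restrict_mem (hH.inter measurableSet_ball)] with y hy
    rw [Real.norm_of_nonneg (Real.rpow_nonneg (hun y hy.1) p)]
    exact Real.rpow_le_rpow (hun y hy.1) (hM y hy.1 (mem_ball_zero_iff.1 hy.2).le) (by linarith)
  · obtain ⟨K, hK0, hK⟩ := exists_logKernel_le_mul hx hz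
    have hm := measurable_logKernel n x
    refine ((h.mono_set sdiff_subset).const_mul K).mono' ?_ ?_
    · exact ((by fun_prop : Measurable fun y => logKernel n x y * ‖y‖ ^ a).aestronglyMeasurable).mul
        (hup.mono_measure (Measure.restrict_mono_set _ sdiff_subset))
    · filter_upwards [ae_restrict_mem (hH.diff measurableSet_ball),
        ae_restrict_of_ae (ae_ne_of_pos hn z)] with y hy hyz
      have h1 := hK y hy.1 hyz (by
        have h2 := hy.2
        rw [mem_ball_zero_iff, not_lt] at h2
        linarith [norm_sub_norm_le y x, norm_sub_rev x y])
      have h0 := logKernel_nonneg hx hy.1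
      have h2 := Real.rpow_nonneg (hun y hy.1) p
      rw [Real.norm_of_nonneg (by positivity)]
      calc logKernel n x y * ‖y‖ ^ a * u y ^ p
          ≤ K * logKernel n z y * ‖y‖ ^ a * u y ^ p := by gcongr
        _ = _ := by ring

/-- A positive continuous solution of the integral equation, with the kernel rewritten as
`c * logKernel` and the integrability of the right-hand side made explicit. -/
structure IsPositiveSolution (n : ℕ) (a p c : ℝ) (u : E n → ℝ) : Prop where
  continuousOn : ContinuousOn u (closure (halfSpace n))
  pos : ∀ x ∈ halfSpace n, 0 < u x
  integrableOn : ∀ x ∈ halfSpace n,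
    IntegrableOn (fun y => logKernel n x y * ‖y‖ ^ a * u y ^ p) (halfSpace n)
  eq_integral : ∀ x ∈ halfSpace n,
    u x = c * ∫ y in halfSpace n, logKernel n x y * ‖y‖ ^ a * u y ^ p

theorem logKernel_pos {n : ℕ} {x y : E n} (hx : x ∈ halfSpace n) (hy : y ∈ halfSpace n)
    (hxy : y ≠ x) : 0 < logKernel n x y := by
  have h1 : 0 < lastCoord n x := hx
  have h2 : 0 < lastCoord n y := hy
  have h0 : 0 < ‖x - y‖ := norm_pos_iff.2 (sub_ne_zero.2 hxy.symm)
  apply Real.log_pos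
  have : 0 < 4 * lastCoord n x * lastCoord n y / ‖x - y‖ ^ 2 := by positivity
  linarith

theorem isPositiveSolution_of_integral_eq {n : ℕ} (hn : 0 < n) {a p Cn : ℝ}
    (ha : -(n : ℝ) < a) (hp : 1 ≤ p) (hCn : 0 < Cn) {u : E n → ℝ}
    (hu : ContinuousOn u (closure (halfSpace n)))
    (hnonneg : ∀ x ∈ closure (halfSpace n), 0 ≤ u x)
    (hie : ∀ x ∈ halfSpace n,
      u x = ∫ y in halfSpace n, Gplus n Cn x y * ‖y‖ ^ a * u y ^ p)
    (hnontriv : ∃ x ∈ halfSpace n, u x ≠ 0) :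
    IsPositiveSolution n a p (Cn / 2) u := by
  have hH := (isOpen_halfSpace n).measurableSet
  have heq (x) (hx : x ∈ halfSpace n) :
      u x = Cn / 2 * ∫ y in halfSpace n, logKernel n x y * ‖y‖ ^ a * u y ^ p := by
    rw [hie x hx, ← integral_const_mul]
    refine setIntegral_congr_ae hH ?_
    filter_upwards [ae_ne_of_pos hn x] with y hyx hy
    rw [Gplus_eq_logKernel hn Cn hx hy hyx]
    ring
  obtain ⟨z, hz, hz0⟩ := hnontriv
  have hzi : IntegrableOn (fun y => logKernel n z y * ‖y‖ ^ a * u y ^ p) (halfSpace n) := by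
    by_contra hni
    exact hz0 (by rw [heq z hz, integral_undef hni, mul_zero])
  have hint (x) (hx : x ∈ halfSpace n) :=
    integrableOn_logKernel_mul_of_integrableOn hn ha hp hu hnonneg hx hz hzi
  have hzpos : 0 < u z := lt_of_le_of_ne (hnonneg z (subset_closure hz)) (Ne.symm hz0)
  refine ⟨hu, fun x hx => ?_, hint, heq⟩
  rw [heq x hx]
  refine mul_pos (by linarith) ((setIntegral_pos_iff_support_of_nonneg_ae ?_ (hint x hx)).2 ?_)
  · filter_upwards [ae_restrict_mem hH] with y hy
    exact mul_nonneg (mul_nonneg (logKernel_nonneg hx hy) (by positivity))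
      (Real.rpow_nonneg (hnonneg y (subset_closure hy)) p)
  · have hopen : IsOpen (halfSpace n ∩ u ⁻¹' Ioi 0) :=
      (hu.mono subset_closure).isOpen_inter_preimage (isOpen_halfSpace n) isOpen_Ioi
    have hvol : 0 < volume ((halfSpace n ∩ u ⁻¹' Ioi 0) \ {x}) := by
      have : Nonempty (Fin n) := ⟨⟨0, hn⟩⟩
      rw [measure_sdiff_null (measure_singleton x)]
      exact hopen.measure_pos volume ⟨z, hz, hzpos⟩
    refine hvol.trans_le (measure_mono ?_)
    rintro y ⟨⟨hy, hy0⟩, hyx⟩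
    refine ⟨ne_of_gt ?_, hy⟩
    have h1 := logKernel_pos hx hy hyx
    have h2 := norm_pos_of_mem_halfSpace hy
    have h3 : 0 < u y := hy0
    positivity

theorem image_inversion_halfSpace_inter_ball {n : ℕ} {l : ℝ} (hl : 0 < l) :
    inversion (0 : E n) l '' (halfSpace n ∩ ball 0 l) = halfSpace n \ closedBall 0 l := by
  ext y
  simp only [mem_image, mem_inter_iff, mem_ball_zero_iff, Set.mem_sdiff, mem_closedBall_zero_iff,
    not_le]
  constructor
  · rintro ⟨x, ⟨hx, hxl⟩, rfl⟩
    have hx0 := norm_pos_of_mem_halfSpace hx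
    refine ⟨inversion_mem_halfSpace hl hx, ?_⟩
    rw [norm_inversion_zero, lt_div_iff₀ hx0]
    nlinarith
  · rintro ⟨hy, hyl⟩
    refine ⟨inversion 0 l y, ⟨inversion_mem_halfSpace hl hy, ?_⟩, inversion_inversion _ hl.ne' y⟩
    rw [norm_inversion_zero, div_lt_iff₀ (by linarith)]
    nlinarith

theorem abs_det_fderiv_inversion {n : ℕ} (l : ℝ) (x : E n) :
    |((l / dist x 0) ^ 2 • ((ℝ ∙ (x - 0))ᗮ.reflection : E n →L[ℝ] E n)).det| =
      (l / ‖x‖) ^ (2 * n) := by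
  have h : ((l / dist x 0) ^ 2 • ((ℝ ∙ (x - 0))ᗮ.reflection : E n →L[ℝ] E n)).det =
      LinearMap.det ((l / dist x 0) ^ 2 • ((ℝ ∙ (x - 0))ᗮ.reflection.toLinearMap)) := rfl
  rw [h, LinearMap.det_smul, Submodule.det_reflection, finrank_euclideanSpace_fin, abs_mul,
    abs_pow, abs_pow, abs_pow, abs_neg, abs_one, one_pow, mul_one, ← pow_mul, dist_zero_right,
    ← abs_pow, abs_of_nonneg (Even.pow_nonneg (even_two_mul n) _)]

/-- Folding the integral over the half space onto the half ball by inversion. -/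
theorem integral_halfSpace_eq_add_inversion {n : ℕ} (hn : 0 < n) {l : ℝ} (hl : 0 < l)
    {g : E n → ℝ} (hg : IntegrableOn g (halfSpace n)) :
    IntegrableOn (fun y => (l / ‖y‖) ^ (2 * n) * g (inversion 0 l y)) (halfSpace n ∩ ball 0 l) ∧
      ∫ y in halfSpace n, g y = (∫ y in halfSpace n ∩ ball 0 l, g y) +
        ∫ y in halfSpace n ∩ ball 0 l, (l / ‖y‖) ^ (2 * n) * g (inversion 0 l y) := by
  have : Nonempty (Fin n) := ⟨⟨0, hn⟩⟩
  have hH := (isOpen_halfSpace n).measurableSet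
  have hS : MeasurableSet (halfSpace n ∩ ball 0 l) := hH.inter measurableSet_ball
  have hderiv : ∀ x ∈ halfSpace n ∩ ball 0 l, HasFDerivWithinAt (inversion (0 : E n) l)
      ((l / dist x 0) ^ 2 • ((ℝ ∙ (x - 0))ᗮ.reflection : E n →L[ℝ] E n))
      (halfSpace n ∩ ball 0 l) x := fun x hx =>
    (hasFDerivAt_inversion (ne_zero_of_mem_halfSpace hx.1)).hasFDerivWithinAt
  have hinj : InjOn (inversion (0 : E n) l) (halfSpace n ∩ ball 0 l) :=
    (inversion_injective _ hl.ne').injOn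
  have h1 := integrableOn_image_iff_integrableOn_abs_det_fderiv_smul volume hS hderiv hinj g
  have h2 := integral_image_eq_integral_abs_det_fderiv_smul volume hS hderiv hinj g
  simp only [abs_det_fderiv_inversion, image_inversion_halfSpace_inter_ball hl, smul_eq_mul]
    at h1 h2
  refine ⟨h1.1 (hg.mono_set sdiff_subset), ?_⟩
  rw [← h2, ← integral_inter_add_sdiff (t := closedBall 0 l) measurableSet_closedBall hg]
  congr 1
  refine setIntegral_congr_set ?_
  refine (ae_eq_refl _).inter ?_
  rw [← ball_union_sphere]
  exact union_ae_eq_left_of_ae_eq_empty (ae_eq_empty.2 (Measure.addHaar_sphere volume 0 l))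

theorem IsPositiveSolution.sub_inversion_eq {n : ℕ} (hn : 0 < n) {a p c : ℝ} {u : E n → ℝ}
    (h : IsPositiveSolution n a p c u) {l : ℝ} (hl : 0 < l) {x : E n} (hx : x ∈ halfSpace n) :
    IntegrableOn (fun y => (logKernel n x y - logKernel n (inversion 0 l x) y) * ‖y‖ ^ a *
        (u y ^ p - (l / ‖y‖) ^ (2 * (n + a)) * u (inversion 0 l y) ^ p))
        (halfSpace n ∩ ball 0 l) ∧
      u x - u (inversion 0 l x) = c * ∫ y in halfSpace n ∩ ball 0 l,
        (logKernel n x y - logKernel n (inversion 0 l x) y) * ‖y‖ ^ a *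
          (u y ^ p - (l / ‖y‖) ^ (2 * (n + a)) * u (inversion 0 l y) ^ p) := by
  have hH := (isOpen_halfSpace n).measurableSet
  have hx' := inversion_mem_halfSpace hl hx
  have hg := (h.integrableOn x hx).sub (h.integrableOn _ hx')
  obtain ⟨h1, h2⟩ := integral_halfSpace_eq_add_inversion hn hl hg
  have hcongr : EqOn (fun y => (((fun y => logKernel n x y * ‖y‖ ^ a * u y ^ p) -
        fun y => logKernel n (inversion 0 l x) y * ‖y‖ ^ a * u y ^ p) y) +
      (l / ‖y‖) ^ (2 * n) * ((fun y => logKernel n x y * ‖y‖ ^ a * u y ^ p) -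
        fun y => logKernel n (inversion 0 l x) y * ‖y‖ ^ a * u y ^ p) (inversion 0 l y))
      (fun y => (logKernel n x y - logKernel n (inversion 0 l x) y) * ‖y‖ ^ a *
        (u y ^ p - (l / ‖y‖) ^ (2 * (n + a)) * u (inversion 0 l y) ^ p))
      (halfSpace n ∩ ball 0 l) := by
    intro y hy
    have hy0 := norm_pos_of_mem_halfSpace hy.1
    simp only [Pi.sub_apply]
    rw [logKernel_inversion_inversion hl hx hy.1, ← logKernel_inversion_left hl hx hy.1,
      norm_inversion_zero]
    have hpow : (l / ‖y‖) ^ (2 * (n + a)) * ‖y‖ ^ a =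
        (l / ‖y‖) ^ (2 * n) * (l ^ 2 / ‖y‖) ^ a := by
      have e1 : l ^ 2 / ‖y‖ = (l / ‖y‖) ^ 2 * ‖y‖ := by field_simp
      rw [e1, Real.mul_rpow (by positivity) hy0.le, ← Real.rpow_natCast (l / ‖y‖) 2,
        ← Real.rpow_mul (by positivity), mul_add, Real.rpow_add (by positivity),
        ← Real.rpow_natCast (l / ‖y‖) (2 * n)]
      push_cast
      ring
    linear_combination (logKernel n x y - logKernel n (inversion 0 l x) y) *
      u (inversion 0 l y) ^ p * hpow
  have hS : MeasurableSet (halfSpace n ∩ ball 0 l) := hH.inter measurableSet_ball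
  have hg' := hg.mono_set (inter_subset_left (t := ball 0 l))
  refine ⟨(hg'.add h1).congr_fun hcongr hS, ?_⟩
  rw [← setIntegral_congr_fun hS hcongr, integral_add hg' h1, ← h2,
    h.eq_integral x hx, h.eq_integral _ hx', ← mul_sub,
    ← integral_sub (h.integrableOn x hx) (h.integrableOn _ hx')]
  rfl

theorem IsPositiveSolution.lt_inversion_of_le {n : ℕ} (hn : 0 < n) {a p c : ℝ} {u : E n → ℝ}
    (h : IsPositiveSolution n a p c u) (ha : -(n : ℝ) < a) (hp : 1 ≤ p) (hc : 0 < c) {l : ℝ}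
    (hle : ∀ y ∈ halfSpace n, ‖y‖ < l → u y ≤ u (inversion 0 l y)) {x : E n}
    (hx : x ∈ halfSpace n) (hxl : ‖x‖ < l) :
    u x < u (inversion 0 l x) := by
  have hl : 0 < l := (norm_nonneg x).trans_lt hxl
  have hH := (isOpen_halfSpace n).measurableSet
  obtain ⟨hint, heq⟩ := h.sub_inversion_eq hn hl hx
  have hneg : ∀ y ∈ halfSpace n ∩ ball 0 l, y ≠ x →
      (logKernel n x y - logKernel n (inversion 0 l x) y) * ‖y‖ ^ a *
        (u y ^ p - (l / ‖y‖) ^ (2 * (n + a)) * u (inversion 0 l y) ^ p) < 0 := by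
    intro y hy hyx
    have hyl := mem_ball_zero_iff.1 hy.2
    have hy0 := norm_pos_of_mem_halfSpace hy.1
    have h1 := logKernel_inversion_lt hx hy.1 hxl hyl hyx
    have h2 : u y ^ p ≤ u (inversion 0 l y) ^ p :=
      Real.rpow_le_rpow (h.pos y hy.1).le (hle y hy.1 hyl) (by linarith)
    have h3 : 1 < (l / ‖y‖) ^ (2 * (n + a)) :=
      Real.one_lt_rpow ((one_lt_div hy0).2 hyl) (by linarith)
    have h4 : 0 < u (inversion 0 l y) ^ p :=
      Real.rpow_pos_of_pos (h.pos _ (inversion_mem_halfSpace hl hy.1)) p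
    refine mul_neg_of_pos_of_neg (mul_pos (by linarith) (by positivity)) ?_
    nlinarith
  have hpos : 0 < ∫ y in halfSpace n ∩ ball 0 l,
      -((logKernel n x y - logKernel n (inversion 0 l x) y) * ‖y‖ ^ a *
        (u y ^ p - (l / ‖y‖) ^ (2 * (n + a)) * u (inversion 0 l y) ^ p)) := by
    refine (setIntegral_pos_iff_support_of_nonneg_ae ?_ hint.neg).2 ?_
    · filter_upwards [ae_restrict_mem (hH.inter measurableSet_ball),
        ae_restrict_of_ae (ae_ne_of_pos hn x)] with y hy hyx
      simpa using (hneg y hy hyx).le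
    · have hvol : 0 < volume ((halfSpace n ∩ ball 0 l) \ {x}) := by
        have : Nonempty (Fin n) := ⟨⟨0, hn⟩⟩
        rw [measure_sdiff_null (measure_singleton x)]
        exact ((isOpen_halfSpace n).inter isOpen_ball).measure_pos volume
          ⟨x, hx, mem_ball_zero_iff.2 hxl⟩
      refine hvol.trans_le (measure_mono ?_)
      rintro y ⟨hy, hyx⟩
      exact ⟨neg_ne_zero.2 (hneg y hy hyx).ne, hy⟩
  rw [integral_neg] at hpos
  nlinarith

theorem rpow_sub_rpow_le {p s t M : ℝ} (hp : 1 ≤ p) (hs : 0 ≤ s) (ht : 0 < t) (htM : t ≤ M)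
    (hst : s ≤ t) : t ^ p - s ^ p ≤ p * M ^ (p - 1) * (t - s) := by
  have h1 := one_add_mul_self_le_rpow_one_add (s := s / t - 1)
    (by linarith [div_nonneg hs ht.le]) hp
  rw [add_sub_cancel, Real.div_rpow hs ht.le, le_div_iff₀ (by positivity)] at h1
  have h2 : t ^ p = t ^ (p - 1) * t := by
    rw [← Real.rpow_add_one ht.ne']; ring_nf
  have h3 : t ^ p - s ^ p ≤ p * t ^ (p - 1) * (t - s) := by
    have : (1 + p * (s / t - 1)) * t ^ p = t ^ p - p * t ^ (p - 1) * (t - s) := by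
      rw [h2]; field_simp; ring
    linarith
  refine h3.trans ?_
  have h4 : t ^ (p - 1) ≤ M ^ (p - 1) := Real.rpow_le_rpow ht.le htM (by linarith)
  have h5 : 0 ≤ t - s := by linarith
  gcongr

theorem continuousOn_inversion_halfSpace (n : ℕ) (l : ℝ) :
    ContinuousOn (inversion (0 : E n) l) (halfSpace n) :=
  continuousOn_const.inversion continuousOn_const continuousOn_id
    fun _ hx => ne_zero_of_mem_halfSpace hx

theorem IsPositiveSolution.isOpen_inversion_lt {n : ℕ} {a p c : ℝ} {u : E n → ℝ}
    (h : IsPositiveSolution n a p c u) {l : ℝ} (hl : 0 < l) :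
    IsOpen {y ∈ halfSpace n ∩ ball 0 l | u (inversion 0 l y) < u y} := by
  have hu : ContinuousOn u (halfSpace n) := h.continuousOn.mono subset_closure
  have hc : ContinuousOn (fun y => u y - u (inversion 0 l y)) (halfSpace n ∩ ball 0 l) :=
    (hu.sub (hu.comp (continuousOn_inversion_halfSpace n l)
      fun _ hx => inversion_mem_halfSpace hl hx)).mono inter_subset_left
  convert hc.isOpen_inter_preimage ((isOpen_halfSpace n).inter isOpen_ball)
    (isOpen_Ioi (a := (0 : ℝ))) using 1
  ext y
  simp

/-- The narrow region principle: the comparison with the inverted solution holds as soon as it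
fails only on a set of small measure. -/
theorem IsPositiveSolution.exists_le_inversion_of_volume_lt {n : ℕ} (hn : 0 < n) {a p c : ℝ}
    {u : E n → ℝ} (h : IsPositiveSolution n a p c u) (ha : -(n : ℝ) < a) (hp : 1 ≤ p)
    (hc : 0 < c) {R : ℝ} (hR : 0 < R) :
    ∃ d : ENNReal, 0 < d ∧ ∀ l, 0 < l → l ≤ R →
      volume {y ∈ halfSpace n ∩ ball 0 l | u (inversion 0 l y) < u y} < d →
        ∀ y ∈ halfSpace n, ‖y‖ < l → u y ≤ u (inversion 0 l y) := by
  obtain ⟨M, hM0, hM⟩ := exists_bound_of_continuousOn h.continuousOn R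
  set K : ℝ := p * M ^ (p - 1) with hK
  have hK0 : 0 < K := by positivity
  obtain ⟨d, hd, hint⟩ := exists_setIntegral_logKernel_le hn ha hR
    (e := 1 / (2 * c * K)) (by positivity)
  refine ⟨d, hd, fun l hl hlR hvol => ?_⟩
  set N : Set (E n) := {y ∈ halfSpace n ∩ ball 0 l | u (inversion 0 l y) < u y} with hN
  have hNm : MeasurableSet N := (h.isOpen_inversion_lt hl).measurableSet
  have hNl : N ⊆ halfSpace n ∩ ball 0 l := fun y hy => hy.1
  have hNR : N ⊆ halfSpace n ∩ ball 0 R :=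
    hNl.trans (inter_subset_inter_right _ (ball_subset_ball hlR))
  have hS : MeasurableSet (halfSpace n ∩ ball 0 l) :=
    (isOpen_halfSpace n).measurableSet.inter measurableSet_ball
  have hstep (S : ℝ) (hS0 : 0 ≤ S)
      (hle : ∀ y ∈ halfSpace n, ‖y‖ < l → u y - u (inversion 0 l y) ≤ S) :
      ∀ y ∈ halfSpace n, ‖y‖ < l → u y - u (inversion 0 l y) ≤ S / 2 := by
    intro x hx hxl
    obtain ⟨hi, heq⟩ := h.sub_inversion_eq hn hl hx
    have hik : IntegrableOn (fun y => logKernel n x y * ‖y‖ ^ a * (K * S)) N :=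
      ((integrableOn_logKernel hn ha hR hx (hxl.trans_le hlR)).mono_set hNR).mul_const _
    have hmono := setIntegral_mono_ae_restrict hi
      (g := N.indicator fun y => logKernel n x y * ‖y‖ ^ a * (K * S))
      (hik.integrable_indicator hNm).integrableOn (by
        filter_upwards [ae_restrict_mem hS, ae_restrict_of_ae (ae_ne_of_pos hn x)] with y hy hyx
        have hyl := mem_ball_zero_iff.1 hy.2
        have hy0 := norm_pos_of_mem_halfSpace hy.1
        have hD := logKernel_inversion_lt hx hy.1 hxl hyl hyx
        have hD0 := logKernel_nonneg (inversion_mem_halfSpace hl hx) hy.1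
        have huy := h.pos y hy.1
        have huσ := h.pos _ (inversion_mem_halfSpace hl hy.1)
        have h1 : u (inversion 0 l y) ^ p ≤
            (l / ‖y‖) ^ (2 * (n + a)) * u (inversion 0 l y) ^ p :=
          le_mul_of_one_le_left (by positivity)
            (Real.one_le_rpow ((one_le_div hy0).2 hyl.le) (by linarith))
        by_cases hyN : y ∈ N
        · rw [indicator_of_mem hyN]
          have hst : u (inversion 0 l y) < u y := hyN.2
          have h2 := rpow_sub_rpow_le hp huσ.le huy (hM y hy.1 (by linarith)) hst.le
          have h3 : u y ^ p - (l / ‖y‖) ^ (2 * (n + a)) * u (inversion 0 l y) ^ p ≤ K * S := by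
            have := mul_le_mul_of_nonneg_left (hle y hy.1 hyl) hK0.le
            linarith
          have h4 : 0 ≤ K * S := by positivity
          have h5 : 0 ≤ (logKernel n x y - logKernel n (inversion 0 l x) y) * ‖y‖ ^ a :=
            mul_nonneg (by linarith) (by positivity)
          refine (mul_le_mul_of_nonneg_left h3 h5).trans ?_
          gcongr
          linarith
        · rw [indicator_of_notMem hyN]
          have hst : u y ≤ u (inversion 0 l y) := not_lt.1 fun hlt => hyN ⟨hy, hlt⟩
          have h2 : u y ^ p ≤ u (inversion 0 l y) ^ p :=
            Real.rpow_le_rpow huy.le hst (by linarith)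
          exact mul_nonpos_of_nonneg_of_nonpos
            (mul_nonneg (by linarith) (by positivity)) (by linarith))
    rw [setIntegral_indicator hNm, inter_eq_self_of_subset_right hNl, integral_mul_const] at hmono
    have hsmall := hint N hNm hNR hvol x hx (hxl.trans_le hlR)
    calc u x - u (inversion 0 l x)
        ≤ c * ((1 / (2 * c * K)) * (K * S)) := by
          rw [heq]
          gcongr
          exact hmono.trans (by gcongr)
      _ = S / 2 := by field_simp
  have hiter (k : ℕ) : ∀ y ∈ halfSpace n, ‖y‖ < l →
      u y - u (inversion 0 l y) ≤ M * (1 / 2) ^ k := by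
    induction k with
    | zero =>
      intro y hy hyl
      have := hM y hy (by linarith)
      have := h.pos _ (inversion_mem_halfSpace hl hy)
      simp only [pow_zero, mul_one]
      linarith
    | succ k ih =>
      intro y hy hyl
      refine (hstep _ (by positivity) ih y hy hyl).trans_eq ?_
      ring
  intro y hy hyl
  have hlim : Tendsto (fun k : ℕ => M * (1 / 2 : ℝ) ^ k) atTop (𝓝 (M * 0)) :=
    (tendsto_pow_atTop_nhds_zero_of_lt_one (by norm_num) (by norm_num)).const_mul M
  have := ge_of_tendsto' hlim fun k => hiter k y hy hyl
  linarith

theorem eventually_volume_ball_sdiff_lt (n : ℕ) {r : ℝ} (hr : 0 ≤ r) {d : ENNReal}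
    (hd : 0 < d) (hn : 0 < n) :
    ∀ᶠ l in 𝓝[>] r, volume (ball (0 : E n) l \ ball 0 r) < d := by
  have : Nonempty (Fin n) := ⟨⟨0, hn⟩⟩
  have hlim : Tendsto (fun l : ℝ => ENNReal.ofReal (l ^ n - r ^ n) * volume (ball (0 : E n) 1))
      (𝓝[>] r) (𝓝 0) := by
    have h1 : Tendsto (fun l : ℝ => ENNReal.ofReal (l ^ n - r ^ n)) (𝓝[>] r) (𝓝 0) := by
      have : ContinuousAt (fun l : ℝ => ENNReal.ofReal (l ^ n - r ^ n)) r :=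
        (ENNReal.continuous_ofReal.comp (by fun_prop)).continuousAt
      simpa [ContinuousAt] using this.mono_left nhdsWithin_le_nhds
    simpa using ENNReal.Tendsto.mul_const h1 (Or.inr measure_ball_lt_top.ne)
  filter_upwards [hlim.eventually_lt_const hd, self_mem_nhdsWithin] with l hl hrl
  have hrl' : r < l := hrl
  rw [measure_sdiff (ball_subset_ball hrl'.le) measurableSet_ball.nullMeasurableSet
    measure_ball_lt_top.ne, Measure.addHaar_ball _ _ (hr.trans hrl'.le),
    Measure.addHaar_ball _ _ hr, finrank_euclideanSpace_fin,
    ← ENNReal.sub_mul fun _ _ => measure_ball_lt_top.ne,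
    ← ENNReal.ofReal_sub _ (by positivity)]
  exact hl

theorem IsPositiveSolution.continuousAt {n : ℕ} {a p c : ℝ} {u : E n → ℝ}
    (h : IsPositiveSolution n a p c u) {x : E n} (hx : x ∈ halfSpace n) : ContinuousAt u x :=
  (h.continuousOn.mono subset_closure).continuousAt ((isOpen_halfSpace n).mem_nhds hx)

theorem IsPositiveSolution.isClosed_le_inversion {n : ℕ} {a p c : ℝ} {u : E n → ℝ}
    (h : IsPositiveSolution n a p c u) {r s : ℝ} (hr : 0 < r) :
    IsClosed ({l : ℝ | ∀ y ∈ halfSpace n, ‖y‖ < l → u y ≤ u (inversion 0 l y)} ∩ Icc r s) := by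
  have heq : {l : ℝ | ∀ y ∈ halfSpace n, ‖y‖ < l → u y ≤ u (inversion 0 l y)} ∩ Icc r s =
      Icc r s ∩ ⋂ y ∈ halfSpace n,
        ((Icc r s ∩ Iic ‖y‖) ∪ {l ∈ Icc r s | u y ≤ u (inversion 0 l y)}) := by
    ext l
    simp only [mem_inter_iff, mem_ofPred_eq, mem_iInter, mem_union, mem_Iic]
    constructor
    · rintro ⟨hl, hlI⟩
      exact ⟨hlI, fun y hy => (le_or_gt l ‖y‖).imp (fun h => ⟨hlI, h⟩) fun h =>
        ⟨hlI, hl y hy h⟩⟩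
    · rintro ⟨hlI, hl⟩
      exact ⟨fun y hy hyl => (hl y hy).elim (fun h => absurd h.2 hyl.not_ge) And.right, hlI⟩
  rw [heq]
  refine isClosed_Icc.inter (isClosed_biInter fun y hy => (isClosed_Icc.inter isClosed_Iic).union ?_)
  refine isClosed_Icc.isClosed_le continuousOn_const fun l hl => ?_
  exact ((h.continuousAt (inversion_mem_halfSpace (hr.trans_le hl.1) hy)).comp
    (f := fun l => inversion (0 : E n) l y)
    (continuousAt_const.inversion continuousAt_id continuousAt_const
      (ne_zero_of_mem_halfSpace hy))).continuousWithinAt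

/-- Strict comparison at radius `r` persists on compact sets for nearby radii. -/
theorem IsPositiveSolution.eventually_lt_inversion {n : ℕ} {a p c : ℝ} {u : E n → ℝ}
    (h : IsPositiveSolution n a p c u) {r : ℝ} (hr : 0 < r) {Q : Set (E n)} (hQ : IsCompact Q)
    (hQH : Q ⊆ halfSpace n) (hlt : ∀ y ∈ Q, u y < u (inversion 0 r y)) :
    ∀ᶠ l in 𝓝 r, ∀ y ∈ Q, u y < u (inversion 0 l y) := by
  refine hQ.eventually_forall_of_forall_eventually fun y hy => ?_
  have hyH := hQH hy
  have h1 : ContinuousAt (fun z : ℝ × E n => u z.2) (r, y) :=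
    ContinuousAt.comp (f := Prod.snd) (h.continuousAt hyH) continuousAt_snd
  have h2 : ContinuousAt (fun z : ℝ × E n => u (inversion 0 z.1 z.2)) (r, y) :=
    ContinuousAt.comp (f := fun z : ℝ × E n => inversion 0 z.1 z.2)
      (h.continuousAt (inversion_mem_halfSpace hr hyH))
      (continuousAt_const.inversion continuousAt_fst continuousAt_snd
        (ne_zero_of_mem_halfSpace hyH))
  exact h1.eventually_lt h2 (hlt y hy)

theorem IsPositiveSolution.le_inversion {n : ℕ} (hn : 0 < n) {a p c : ℝ} {u : E n → ℝ}
    (h : IsPositiveSolution n a p c u) (ha : -(n : ℝ) < a) (hp : 1 ≤ p) (hc : 0 < c) {l : ℝ}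
    {y : E n} (hy : y ∈ halfSpace n) (hyl : ‖y‖ < l) :
    u y ≤ u (inversion 0 l y) := by
  have hl : 0 < l := (norm_nonneg y).trans_lt hyl
  obtain ⟨d, hd, hnarrow⟩ := h.exists_le_inversion_of_volume_lt hn ha hp hc hl
  obtain ⟨r, hr, hr0, hrl⟩ : ∃ r, volume (ball (0 : E n) r \ ball 0 0) < d ∧ 0 < r ∧ r < l :=
    ((eventually_volume_ball_sdiff_lt n le_rfl hd hn).and (Ioo_mem_nhdsGT hl)).exists
  have hsub : Icc r l ⊆ {l : ℝ | ∀ y ∈ halfSpace n, ‖y‖ < l → u y ≤ u (inversion 0 l y)} := by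
    refine (h.isClosed_le_inversion hr0).Icc_subset_of_forall_mem_nhdsWithin ?_ ?_
    · refine hnarrow r hr0 hrl.le ((measure_mono ?_).trans_lt hr)
      rw [ball_zero, sdiff_empty]
      exact fun y hy => hy.1.2
    · rintro s ⟨hs, hrs, hsl⟩
      have hs0 : 0 < s := hr0.trans_le hrs
      have hS : MeasurableSet (halfSpace n ∩ ball 0 s) :=
        (isOpen_halfSpace n).measurableSet.inter measurableSet_ball
      obtain ⟨Q, hQs, hQ, hQd⟩ := hS.exists_isCompact_sdiff_lt (μ := volume)
        ((measure_mono inter_subset_right).trans_lt measure_ball_lt_top).ne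
        (ENNReal.half_pos hd.ne').ne'
      have hlt : ∀ y ∈ Q, u y < u (inversion 0 s y) := fun y hy =>
        h.lt_inversion_of_le hn ha hp hc hs (hQs hy).1 (mem_ball_zero_iff.1 (hQs hy).2)
      filter_upwards [nhdsWithin_le_nhds (h.eventually_lt_inversion hs0 hQ
        (fun y hy => (hQs hy).1) hlt), Ioo_mem_nhdsGT hsl,
        eventually_volume_ball_sdiff_lt n hs0.le (ENNReal.half_pos hd.ne') hn] with t ht hst hvol
      refine hnarrow t (hs0.trans hst.1) hst.2.le ?_
      calc volume {y ∈ halfSpace n ∩ ball 0 t | u (inversion 0 t y) < u y}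
          ≤ volume ((ball 0 t \ ball 0 s) ∪ ((halfSpace n ∩ ball 0 s) \ Q)) := by
            refine measure_mono fun y hy => ?_
            by_cases hys : y ∈ ball 0 s
            · exact Or.inr ⟨⟨hy.1.1, hys⟩, fun hyQ => lt_asymm hy.2 (ht y hyQ)⟩
            · exact Or.inl ⟨hy.1.2, hys⟩
        _ ≤ _ := measure_union_le _ _
        _ < d / 2 + d / 2 := ENNReal.add_lt_add hvol hQd
        _ = d := ENNReal.add_halves d
  exact hsub ⟨hrl.le, le_rfl⟩ y hy hyl

theorem mem_halfSpace_of_norm_div_sqrt_le {n : ℕ} (hn : 0 < n) {x : E n} (hx0 : 0 < ‖x‖)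
    (hx : ‖x‖ / √n ≤ lastCoord n x) : x ∈ halfSpace n := by
  have : (0 : ℝ) < n := by exact_mod_cast hn
  exact lt_of_lt_of_le (by positivity : 0 < ‖x‖ / √n) hx

theorem IsPositiveSolution.exists_pos_le_of_mem_cone {n : ℕ} (hn : 0 < n) {a p c : ℝ}
    {u : E n → ℝ} (h : IsPositiveSolution n a p c u) (ha : -(n : ℝ) < a) (hp : 1 ≤ p)
    (hc : 0 < c) :
    ∃ C : ℝ, 0 < C ∧ ∀ x : E n, 1 ≤ ‖x‖ → ‖x‖ / √n ≤ lastCoord n x → C ≤ u x := by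
  set K : Set (E n) := sphere 0 1 ∩ {y | 1 / √n ≤ lastCoord n y} with hK
  have hKc : IsCompact K :=
    (isCompact_sphere 0 1).inter_right (isClosed_le continuous_const (continuous_lastCoord n))
  have hKH : K ⊆ halfSpace n := by
    rintro y ⟨hy1, hy⟩
    rw [mem_sphere_zero_iff_norm] at hy1
    exact mem_halfSpace_of_norm_div_sqrt_le hn (by linarith) (by rw [hy1]; exact hy)
  obtain ⟨C, hC0, hC⟩ := hKc.exists_forall_le' (h.continuousOn.mono (hKH.trans subset_closure))
    (a := 0) fun y hy => h.pos y (hKH hy)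
  refine ⟨C, hC0, fun x hx1 hx => ?_⟩
  have hx0 : 0 < ‖x‖ := by linarith
  have hy1 : ‖‖x‖⁻¹ • x‖ = 1 := by
    rw [norm_smul, norm_inv, norm_norm, inv_mul_cancel₀ hx0.ne']
  have hyK : ‖x‖⁻¹ • x ∈ K := by
    refine ⟨mem_sphere_zero_iff_norm.2 hy1, ?_⟩
    change 1 / √n ≤ lastCoord n (‖x‖⁻¹ • x)
    rw [lastCoord_smul, ← div_eq_inv_mul, le_div_iff₀ hx0]
    linarith [div_eq_mul_one_div ‖x‖ √n]
  refine (hC _ hyK).trans ?_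
  rcases hx1.eq_or_lt with h1 | h1
  · rw [← h1]; simp
  · have := h.le_inversion hn ha hp hc (l := √‖x‖) (hKH hyK)
      (by rw [hy1]; exact Real.lt_sqrt_of_sq_lt (by simpa using h1))
    rwa [inversion_zero_eq, hy1, div_one, Real.sq_sqrt hx0.le, smul_smul,
      mul_inv_cancel₀ hx0.ne', one_smul] at this

theorem norm_div_sqrt_le_lastCoord {n : ℕ} (hn : 0 < n) {y : E n} {r : ℝ}
    (hy : ‖y‖ ≤ 8 / 5 * r) (hyn : 7 / 5 * r ≤ lastCoord n y) (hr : 0 < r) :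
    ‖y‖ / √n ≤ lastCoord n y := by
  rcases Nat.lt_or_ge 1 n with h | h
  · have h2 : (2 : ℝ) ≤ n := by exact_mod_cast h
    have h3 : 8 / 7 ≤ √n := Real.le_sqrt_of_sq_le (by linarith)
    rw [div_le_iff₀ (by linarith)]
    nlinarith
  · obtain rfl : n = 1 := le_antisymm h hn
    have h1 : ‖y‖ = |y 0| := by simp [EuclideanSpace.norm_eq, Real.sqrt_sq_eq_abs]
    have h2 : lastCoord 1 y = y 0 := by simp [lastCoord]
    rw [h2] at hyn ⊢
    rw [h1, abs_of_pos (by linarith)]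
    simp

theorem two_rpow_neg_abs_mul_le {r t : ℝ} (a : ℝ) (hr : 0 < r) (hrt : r ≤ t) (ht : t ≤ 2 * r) :
    2 ^ (-|a|) * r ^ a ≤ t ^ a := by
  have h1 : 1 ≤ t / r := (one_le_div hr).2 hrt
  have h2 : (2 : ℝ) ^ (-|a|) ≤ (t / r) ^ a :=
    (Real.rpow_le_rpow_of_nonpos (by linarith) ((div_le_iff₀ hr).2 ht)
      (neg_nonpos.2 (abs_nonneg a))).trans
      (Real.rpow_le_rpow_of_exponent_le h1 (neg_abs_le a))
  have h3 : t ^ a = (t / r) ^ a * r ^ a := by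
    rw [← Real.mul_rpow (by linarith) hr.le, div_mul_cancel₀ _ hr.ne']
  rw [h3]
  gcongr

/-- A power lower bound on the cone improves its exponent by `n + a`. -/
theorem IsPositiveSolution.exists_rpow_add_le_of_mem_cone {n : ℕ} (hn : 0 < n) {a p c : ℝ}
    {u : E n → ℝ} (h : IsPositiveSolution n a p c u) (hp : 1 ≤ p) (hc : 0 < c) {m C : ℝ}
    (hm : 0 ≤ m) (hC0 : 0 < C)
    (hC : ∀ x : E n, 1 ≤ ‖x‖ → ‖x‖ / √n ≤ lastCoord n x → C * ‖x‖ ^ m ≤ u x) :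
    ∃ C' : ℝ, 0 < C' ∧ ∀ x : E n, 1 ≤ ‖x‖ → ‖x‖ / √n ≤ lastCoord n x →
      C' * ‖x‖ ^ (m + (n + a)) ≤ u x := by
  have : Nonempty (Fin n) := ⟨⟨0, hn⟩⟩
  have hn' : (0 : ℝ) < n := by exact_mod_cast hn
  set L : ℝ := Real.log (1 + 1 / (2 * √n))
  have hL : 0 < L := Real.log_pos (by linarith [(by positivity : 0 < 1 / (2 * √(n : ℝ)))])
  set V : ℝ := volume.real (ball (0 : E n) 1)
  have hV : 0 < V :=
    ENNReal.toReal_pos (measure_ball_pos volume 0 one_pos).ne' measure_ball_lt_top.ne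
  refine ⟨c * (L * 2 ^ (-|a|) * C ^ p * ((1 / 10) ^ n * V)), by positivity, fun x hx1 hx => ?_⟩
  set r := ‖x‖
  have hr : 0 < r := by linarith
  have hxH := mem_halfSpace_of_norm_div_sqrt_le hn hr hx
  set B : Set (E n) := ball ((3 / 2 * r) • lastBasis n) (1 / 10 * r)
  have hB {y : E n} (hy : y ∈ B) :
      7 / 5 * r ≤ ‖y‖ ∧ ‖y‖ ≤ 8 / 5 * r ∧ 7 / 5 * r ≤ lastCoord n y := by
    have h1 : ‖y - (3 / 2 * r) • lastBasis n‖ < 1 / 10 * r := mem_ball_iff_norm.1 hy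
    have h2 : ‖(3 / 2 * r) • lastBasis n‖ = 3 / 2 * r := by
      rw [norm_smul, norm_lastBasis hn, Real.norm_of_nonneg (by positivity), mul_one]
    have h3 := abs_le.1 ((abs_norm_sub_norm_le y ((3 / 2 * r) • lastBasis n)).trans h1.le)
    have h4 := abs_le.1 ((abs_lastCoord_le n (y - (3 / 2 * r) • lastBasis n)).trans h1.le)
    rw [lastCoord_sub, lastCoord_smul, lastCoord_lastBasis hn] at h4
    rw [h2] at h3
    refine ⟨?_, ?_, ?_⟩ <;> linarith [h3.1, h3.2, h4.1]
  have hBH : B ⊆ halfSpace n := fun y hy => by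
    have : 0 < lastCoord n y := by linarith [(hB hy).2.2]
    exact this
  have hbound : ∀ y ∈ B, y ≠ x → L * (2 ^ (-|a|) * r ^ a) * (C ^ p * r ^ m) ≤
      logKernel n x y * ‖y‖ ^ a * u y ^ p := by
    intro y hy hyx
    obtain ⟨hy1, hy2, hyn⟩ := hB hy
    have hk : L ≤ logKernel n x y := by
      have hd : 0 < ‖x - y‖ := norm_pos_iff.2 (sub_ne_zero.2 hyx.symm)
      have hd3 : ‖x - y‖ ^ 2 ≤ (13 / 5 * r) ^ 2 := by
        gcongr
        linarith [norm_sub_le x y]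
      have h1 : 1 / (2 * √n) ≤ 4 * lastCoord n x * lastCoord n y / ‖x - y‖ ^ 2 := by
        rw [le_div_iff₀ (by positivity)]
        have h2 : r / √n * (7 / 5 * r) ≤ lastCoord n x * lastCoord n y :=
          mul_le_mul hx hyn (by positivity) (le_of_lt hxH)
        calc 1 / (2 * √n) * ‖x - y‖ ^ 2 ≤ 1 / (2 * √n) * (13 / 5 * r) ^ 2 := by gcongr
          _ = (169 / 50) * (r / √n * r) := by ring
          _ ≤ 4 * (r / √n * (7 / 5 * r)) := by
            linarith [(by positivity : 0 < r / √n * r)]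
          _ ≤ _ := by linarith
      exact Real.log_le_log (by positivity) (by linarith)
    have hka := two_rpow_neg_abs_mul_le a hr (by linarith : r ≤ ‖y‖) (by linarith)
    have hku : C ^ p * r ^ m ≤ u y ^ p := by
      have h1 := hC y (by linarith) (norm_div_sqrt_le_lastCoord hn hy2 hyn hr)
      have h2 : r ^ m ≤ ‖y‖ ^ m := Real.rpow_le_rpow hr.le (by linarith) hm
      calc C ^ p * r ^ m ≤ C ^ p * r ^ (m * p) := by
            gcongr
            exact le_mul_of_one_le_right hm hp
        _ = (C * r ^ m) ^ p := by
            rw [Real.mul_rpow hC0.le (by positivity), ← Real.rpow_mul hr.le]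
        _ ≤ u y ^ p := by
            refine Real.rpow_le_rpow (by positivity) (le_trans ?_ h1) (by linarith)
            gcongr
    have hk0 := logKernel_nonneg hxH (hBH hy)
    gcongr
  have hi := h.integrableOn x hxH
  have hvol : volume.real B = r ^ n * ((1 / 10) ^ n * V) := by
    rw [measureReal_def, Measure.addHaar_ball _ _ (by positivity), finrank_euclideanSpace_fin,
      ENNReal.toReal_mul, ENNReal.toReal_ofReal (by positivity)]
    change _ * V = _
    ring
  have hmono : L * (2 ^ (-|a|) * r ^ a) * (C ^ p * r ^ m) * volume.real B ≤
      ∫ y in halfSpace n, logKernel n x y * ‖y‖ ^ a * u y ^ p := by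
    calc L * (2 ^ (-|a|) * r ^ a) * (C ^ p * r ^ m) * volume.real B
        = ∫ _ in B, L * (2 ^ (-|a|) * r ^ a) * (C ^ p * r ^ m) := by
          rw [setIntegral_const, smul_eq_mul, mul_comm]
      _ ≤ ∫ y in B, logKernel n x y * ‖y‖ ^ a * u y ^ p := by
          refine setIntegral_mono_ae_restrict
            (integrableOn_const measure_ball_lt_top.ne) (hi.mono_set hBH) ?_
          filter_upwards [ae_restrict_mem measurableSet_ball,
            ae_restrict_of_ae (ae_ne_of_pos hn x)] with y hy hyx
          exact hbound y hy hyx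
      _ ≤ _ := by
          refine setIntegral_mono_set hi ?_ (Eventually.of_forall hBH)
          filter_upwards [ae_restrict_mem (isOpen_halfSpace n).measurableSet] with y hy
          exact mul_nonneg (mul_nonneg (logKernel_nonneg hxH hy) (by positivity))
            (Real.rpow_nonneg (h.pos y hy).le p)
  rw [h.eq_integral x hxH]
  calc c * (L * 2 ^ (-|a|) * C ^ p * ((1 / 10) ^ n * V)) * r ^ (m + (n + a))
      = c * (L * (2 ^ (-|a|) * r ^ a) * (C ^ p * r ^ m) * volume.real B) := by
        rw [hvol, Real.rpow_add hr, Real.rpow_add hr, Real.rpow_natCast]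
        ring
    _ ≤ _ := by gcongr

theorem IsPositiveSolution.exists_rpow_natCast_mul_le_of_mem_cone {n : ℕ} (hn : 0 < n)
    {a p c : ℝ} {u : E n → ℝ} (h : IsPositiveSolution n a p c u) (ha : -(n : ℝ) < a)
    (hp : 1 ≤ p) (hc : 0 < c) (k : ℕ) :
    ∃ C : ℝ, 0 < C ∧ ∀ x : E n, 1 ≤ ‖x‖ → ‖x‖ / √n ≤ lastCoord n x →
      C * ‖x‖ ^ (k * (n + a)) ≤ u x := by
  induction k with
  | zero => simpa using h.exists_pos_le_of_mem_cone hn ha hp hc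
  | succ k ih =>
    obtain ⟨C, hC0, hC⟩ := ih
    have hm : 0 ≤ k * (n + a) := mul_nonneg k.cast_nonneg (by linarith)
    simpa [add_one_mul] using h.exists_rpow_add_le_of_mem_cone hn hp hc hm hC0 hC

theorem cone_lower_bounds (n : ℕ) (hn : 1 ≤ n) (a p Cn : ℝ)
    (ha : -(n : ℝ) < a) (hp : 1 ≤ p) (hCn : 0 < Cn)
    (u : E n → ℝ)
    (hu : ContinuousOn u (closure (halfSpace n)))
    (hnonneg : ∀ x ∈ closure (halfSpace n), 0 ≤ u x)
    (hie : ∀ x ∈ halfSpace n,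
      u x = ∫ y in halfSpace n, Gplus n Cn x y * ‖y‖ ^ a * u y ^ p)
    (hnontriv : ∃ x ∈ halfSpace n, u x ≠ 0) :
    ∀ κ : ℝ, ∃ Cκ : ℝ, 0 < Cκ ∧
      ∀ x ∈ halfSpace n, 1 ≤ ‖x‖ → ‖x‖ / Real.sqrt n ≤ lastCoord n x →
        Cκ * ‖x‖ ^ κ ≤ u x := by
  have h := isPositiveSolution_of_integral_eq hn ha hp hCn hu hnonneg hie hnontriv
  intro κ
  obtain ⟨k, hk⟩ := exists_nat_ge (κ / (n + a))
  rw [div_le_iff₀ (by linarith)] at hk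
  obtain ⟨C, hC0, hC⟩ :=
    h.exists_rpow_natCast_mul_le_of_mem_cone hn ha hp (by positivity) k
  refine ⟨C, hC0, fun x _ hx1 hx => (hC x hx1 hx).trans' ?_⟩
  gcongr
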